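/- arXiv:1208.4394 — 2 statements merged into one kernel-verified Lean document; each statement's English description precedes it below -/
import Mathlib

section
/- Let f be an expansive homeomorphism of a compact, connected, locally connected metric space M containing more than one point. Then f has no Lyapunov stable points. -/
/-- A point is Lyapunov stable for (the iterates of) `f`. -/
def LyapunovStable {M : Type*} [MetricSpace M] (f : Equiv.Perm M) (x : M) : Prop :=
  ∀ ε > (0 : ℝ), ∃ δ > (0 : ℝ), ∀ y : M, dist x y < δ →
    ∀ n : ℕ, dist ((f ^ n) x) ((f ^ n) y) < ε

section Expansive

variable {M : Type*} [MetricSpace M] {f : Equiv.Perm M}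

theorem Equiv.Perm.continuous_zpow (hf : Continuous f) (hf' : Continuous f.symm) (n : ℤ) :
    Continuous (f ^ n : Equiv.Perm M) := by
  cases n with
  | ofNat n =>
    rw [Int.ofNat_eq_natCast, zpow_natCast, Equiv.Perm.coe_pow]
    exact hf.iterate n
  | negSucc n =>
    rw [zpow_negSucc, ← inv_pow, Equiv.Perm.coe_pow]
    exact hf'.iterate (n + 1)

theorem Equiv.Perm.continuous_pow (hf : Continuous f) (n : ℕ) :
    Continuous (f ^ n : Equiv.Perm M) := by
  rw [Equiv.Perm.coe_pow]
  exact hf.iterate n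

/-- In a compact locally connected metric space, nearby points lie in small connected sets. -/
theorem exists_small_preconnected_of_dist_lt [CompactSpace M] [LocallyConnectedSpace M]
    {r : ℝ} (hr : 0 < r) :
    ∃ s > 0, ∀ p q : M, dist q p < s →
      ∃ C : Set M, IsPreconnected C ∧ p ∈ C ∧ q ∈ C ∧ ∀ c ∈ C, dist c p < r := by
  obtain ⟨s, hs, h⟩ := lebesgue_number_lemma_of_metric (isCompact_univ (X := M))
    (c := fun z => connectedComponentIn (Metric.ball z (r / 2)) z)
    (fun z => Metric.isOpen_ball.connectedComponentIn)
    (fun z _ => Set.mem_iUnion.2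
      ⟨z, mem_connectedComponentIn (Metric.mem_ball_self (half_pos hr))⟩)
  refine ⟨s, hs, fun p q hpq => ?_⟩
  obtain ⟨z, hz⟩ := h p (Set.mem_univ p)
  have hp := hz (Metric.mem_ball_self hs)
  refine ⟨_, isPreconnected_connectedComponentIn, hp, hz hpq, fun c hc => ?_⟩
  have h1 := Metric.mem_ball.1 (connectedComponentIn_subset _ _ hc)
  have h2 := Metric.mem_ball'.1 (connectedComponentIn_subset _ _ hp)
  linarith [dist_triangle c z p]

/-- Finitely many iterates of a continuous map are uniformly equicontinuous. -/
theorem exists_dist_pow_lt_of_lt [CompactSpace M] (hf : Continuous f) (N : ℕ) {η : ℝ}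
    (hη : 0 < η) :
    ∃ δ > 0, ∀ a b : M, dist a b < δ → ∀ k < N, dist ((f ^ k) a) ((f ^ k) b) < η := by
  induction N with
  | zero => exact ⟨1, one_pos, fun a b _ k hk => absurd hk k.not_lt_zero⟩
  | succ N ih =>
    obtain ⟨δ, hδ, h⟩ := ih
    obtain ⟨δ', hδ', h'⟩ := Metric.uniformContinuous_iff.1
      (CompactSpace.uniformContinuous_of_continuous (Equiv.Perm.continuous_pow hf N)) η hη
    refine ⟨min δ δ', lt_min hδ hδ', fun a b hab k hk => ?_⟩
    rcases Nat.lt_succ_iff_lt_or_eq.1 hk with hk | rfl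
    · exact h a b (hab.trans_le (min_le_left _ _)) k hk
    · exact h' (hab.trans_le (min_le_right _ _))

/-- Expansiveness is uniform: staying `β`-close for a long time forces being `η`-close. -/
theorem exists_dist_lt_of_forall_natAbs_le [CompactSpace M] (hf : Continuous f)
    (hf' : Continuous f.symm) {β : ℝ}
    (hexp : ∀ x y : M, (∀ n : ℤ, dist ((f ^ n) x) ((f ^ n) y) ≤ β) → x = y)
    {η : ℝ} (hη : 0 < η) :
    ∃ N : ℕ, ∀ a b : M,
      (∀ n : ℤ, n.natAbs ≤ N → dist ((f ^ n) a) ((f ^ n) b) ≤ β) → dist a b < η := by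
  by_contra! hcon
  let K : ℕ → Set (M × M) := fun N => {p | η ≤ dist p.1 p.2 ∧
    ∀ n : ℤ, n.natAbs ≤ N → dist ((f ^ n) p.1) ((f ^ n) p.2) ≤ β}
  have hK : ∀ N, IsClosed (K N) := fun N => by
    refine (isClosed_le continuous_const continuous_dist).inter ?_
    change IsClosed {p : M × M | ∀ n : ℤ, n.natAbs ≤ N → dist ((f ^ n) p.1) ((f ^ n) p.2) ≤ β}
    simp only [Set.ofPred_forall]
    refine isClosed_iInter fun n => isClosed_iInter fun _ => ?_
    have hn := Equiv.Perm.continuous_zpow hf hf' n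
    exact isClosed_le ((hn.comp continuous_fst).dist (hn.comp continuous_snd)) continuous_const
  obtain ⟨p, hp⟩ := IsCompact.nonempty_iInter_of_sequence_nonempty_isCompact_isClosed K
    (fun N p hp => ⟨hp.1, fun n hn => hp.2 n (hn.trans N.le_succ)⟩)
    (fun N => by
      obtain ⟨a, b, h, h'⟩ := hcon N
      exact ⟨(a, b), h', h⟩)
    (hK 0).isCompact hK
  rw [Set.mem_iInter] at hp
  have heq := hexp p.1 p.2 fun n => (hp n.natAbs).2 n le_rfl
  have := (hp 0).1
  rw [heq, dist_self] at this
  linarith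

/-- Points whose forward orbits stay `β`-close are uniformly forward asymptotic. -/
theorem exists_forall_ge_dist_pow_lt [CompactSpace M] (hf : Continuous f)
    (hf' : Continuous f.symm) {β : ℝ}
    (hexp : ∀ x y : M, (∀ n : ℤ, dist ((f ^ n) x) ((f ^ n) y) ≤ β) → x = y)
    {η : ℝ} (hη : 0 < η) :
    ∃ N : ℕ, ∀ a b : M, (∀ k : ℕ, dist ((f ^ k) a) ((f ^ k) b) ≤ β) →
      ∀ k ≥ N, dist ((f ^ k) a) ((f ^ k) b) < η := by
  obtain ⟨N, hN⟩ := exists_dist_lt_of_forall_natAbs_le hf hf' hexp hη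
  refine ⟨N, fun a b hab k hk => hN _ _ fun n hn => ?_⟩
  obtain ⟨m, hm⟩ := Int.eq_ofNat_of_zero_le (show 0 ≤ n + k by lia)
  have h := hab m
  rwa [← zpow_natCast, ← hm, zpow_add, zpow_natCast, Equiv.Perm.mul_apply,
    Equiv.Perm.mul_apply] at h

/-- Points near a Lyapunov stable point of an expansive homeomorphism are Lyapunov stable. -/
theorem LyapunovStable.exists_forall_dist_lt [CompactSpace M] (hf : Continuous f)
    (hf' : Continuous f.symm) {β : ℝ} (hβ : 0 < β)
    (hexp : ∀ x y : M, (∀ n : ℤ, dist ((f ^ n) x) ((f ^ n) y) ≤ β) → x = y)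
    {x : M} (hx : LyapunovStable f x) :
    ∃ δ > 0, ∀ y : M, dist x y < δ → LyapunovStable f y := by
  obtain ⟨δ, hδ, h⟩ := hx (β / 2) (half_pos hβ)
  refine ⟨δ, hδ, fun y hy ε hε => ?_⟩
  obtain ⟨N, hN⟩ := exists_forall_ge_dist_pow_lt hf hf' hexp hε
  obtain ⟨δ', hδ', h'⟩ := exists_dist_pow_lt_of_lt hf N hε
  refine ⟨min δ' (δ - dist x y), lt_min hδ' (sub_pos.2 hy), fun z hz k => ?_⟩
  rcases lt_or_ge k N with hk | hk
  · exact h' y z (hz.trans_le (min_le_left _ _)) k hk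
  · refine hN y z (fun j => ?_) k hk
    have hxz : dist x z < δ := by
      linarith [dist_triangle x y z, hz.trans_le (min_le_right _ _)]
    have := dist_triangle_left ((f ^ j) y) ((f ^ j) z) ((f ^ j) x)
    linarith [h y hy j, h z hxz j]

/-- The local stable sets along the backward orbit of a Lyapunov stable point contain balls of a
uniform radius. -/
theorem LyapunovStable.exists_uniform_radius [CompactSpace M] [LocallyConnectedSpace M]
    (hf : Continuous f) (hf' : Continuous f.symm) {β : ℝ} (hβ : 0 < β)
    (hexp : ∀ x y : M, (∀ n : ℤ, dist ((f ^ n) x) ((f ^ n) y) ≤ β) → x = y)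
    {x : M} (hx : LyapunovStable f x) :
    ∃ σ > 0, ∀ (n : ℕ) (p q : M), (f ^ n) p = x → dist q p < σ →
      ∀ k : ℕ, dist ((f ^ k) q) ((f ^ k) p) ≤ β := by
  obtain ⟨δ, hδ, hst⟩ := hx β hβ
  obtain ⟨η, hη, hηm⟩ := exists_between (lt_min hδ hβ)
  obtain ⟨hηδ, hηβ⟩ := lt_min_iff.1 hηm
  obtain ⟨N, hN⟩ := exists_forall_ge_dist_pow_lt hf hf' hexp hη
  obtain ⟨r, hr, hr'⟩ := exists_dist_pow_lt_of_lt hf N hη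
  obtain ⟨σ, hσ, hconn⟩ := exists_small_preconnected_of_dist_lt (M := M) hr
  refine ⟨σ, hσ, fun n p q hp hpq => ?_⟩
  obtain ⟨C, hC, hpC, hqC, hCr⟩ := hconn p q hpq
  have hstay : ∀ c, (∀ k ≤ n, dist ((f ^ k) c) ((f ^ k) p) ≤ η) →
      ∀ k : ℕ, dist ((f ^ k) c) ((f ^ k) p) ≤ β := fun c hc k => by
    rcases le_total k n with hk | hk
    · exact (hc k hk).trans hηβ.le
    · obtain ⟨j, rfl⟩ := Nat.exists_eq_add_of_le' hk
      have h := hst ((f ^ n) c) (by rw [← hp, dist_comm]; exact (hc n le_rfl).trans_lt hηδ) j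
      rw [pow_add, Equiv.Perm.mul_apply, Equiv.Perm.mul_apply, hp, dist_comm]
      exact h.le
  have hcont : ∀ k : ℕ, Continuous fun c => dist ((f ^ k) c) ((f ^ k) p) := fun k =>
    (Equiv.Perm.continuous_pow hf k).dist continuous_const
  let U : Set M := ⋂ k ∈ Set.Iic n, {c | dist ((f ^ k) c) ((f ^ k) p) < η}
  have hU : IsOpen U := (Set.finite_Iic n).isOpen_biInter fun k _ =>
    isOpen_lt (hcont k) continuous_const
  have hpU : p ∈ U := by simp [U, hη]
  have hsub : C ⊆ U := by
    refine hC.subset_of_closure_inter_subset hU ⟨p, hpC, hpU⟩ ?_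
    rintro c ⟨hcU, hcC⟩
    have hle : ∀ k ≤ n, dist ((f ^ k) c) ((f ^ k) p) ≤ η := fun k hk =>
      closure_minimal (t := {c | dist ((f ^ k) c) ((f ^ k) p) ≤ η})
        (fun c' hc' => le_of_lt (α := ℝ) (Set.mem_iInter₂.1 hc' k hk))
        (isClosed_le (hcont k) continuous_const) hcU
    refine Set.mem_iInter₂.2 fun k _ => ?_
    rcases lt_or_ge k N with hk | hk
    · exact hr' c p (hCr c hcC) k hk
    · exact hN c p (hstay c hle) k hk
  exact hstay q fun k hk => (Set.mem_iInter₂.1 (hsub hqC) k hk).le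

/-- A Lyapunov stable point of an expansive homeomorphism is periodic. -/
theorem LyapunovStable.exists_pow_eq_self [CompactSpace M] [LocallyConnectedSpace M]
    (hf : Continuous f) (hf' : Continuous f.symm) {β : ℝ} (hβ : 0 < β)
    (hexp : ∀ x y : M, (∀ n : ℤ, dist ((f ^ n) x) ((f ^ n) y) ≤ β) → x = y)
    {x : M} (hx : LyapunovStable f x) :
    ∃ k > 0, (f ^ k) x = x := by
  obtain ⟨σ, hσ, h⟩ := hx.exists_uniform_radius hf hf' hβ hexp
  obtain ⟨t, -, ht, hcov⟩ :=
    Metric.finite_approx_of_totallyBounded (isCompact_univ (X := M)).totallyBounded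
      (σ / 2) (half_pos hσ)
  have hcov' : ∀ z : M, ∃ c ∈ t, dist z c < σ / 2 := fun z => by
    simpa using hcov (Set.mem_univ z)
  choose g hgt hg using hcov'
  by_contra! hper
  let p : ℕ → M := fun n => (f ^ n)⁻¹ x
  have hp : ∀ n, (f ^ n) (p n) = x := fun n => (f ^ n).apply_symm_apply x
  have hpadd : ∀ m n, (f ^ m) (p (m + n)) = p n := fun m n => by
    rw [Equiv.Perm.eq_inv_iff_eq, ← Equiv.Perm.mul_apply, ← pow_add, add_comm, hp]
  have hpne : ∀ k > 0, p k ≠ x := fun k hk heq => hper k hk (by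
    conv_lhs => rw [← heq]
    exact hp k)
  obtain ⟨i, -, hi⟩ := Finset.exists_min_image (Finset.range (ht.toFinset.card + 1))
    (fun i => dist (p (i + 1)) x) Finset.nonempty_range_add_one
  obtain ⟨N, hN⟩ := exists_forall_ge_dist_pow_lt hf hf' hexp
    (dist_pos.2 (hpne (i + 1) i.succ_pos))
  obtain ⟨a, ha, b, hb, hab, hgab⟩ := Finset.exists_ne_map_eq_of_card_lt_of_maps_to
    (s := Finset.range (ht.toFinset.card + 1)) (t := ht.toFinset)
    (f := fun a => g (p (N + a))) (by simp) (fun a _ => by simpa using hgt _)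
  wlog hlt : a < b generalizing a b
  · exact this b hb a ha hab.symm hgab.symm (by lia)
  have hdist : dist (p (N + b)) (p (N + a)) < σ := by
    have h1 := hg (p (N + b))
    have h2 := hg (p (N + a))
    rw [show g (p (N + a)) = g (p (N + b)) from hgab] at h2
    linarith [dist_triangle_right (p (N + b)) (p (N + a)) (g (p (N + b)))]
  have hclose := hN _ _ (h (N + a) _ _ (hp _) hdist) (N + a) (by lia)
  rw [hp, show N + b = (N + a) + (b - a - 1 + 1) by lia, hpadd] at hclose
  exact hclose.not_ge (hi (b - a - 1) (by simp at hb ⊢; lia))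

end Expansive

/-- Lewowicz, no stable points: an expansive homeomorphism of a
compact connected locally connected nontrivial metric space has no Lyapunov
stable points. -/
theorem no_lyapunov_stable_points {M : Type*} [MetricSpace M] [CompactSpace M]
    [ConnectedSpace M] [LocallyConnectedSpace M] [Nontrivial M]
    (f : Equiv.Perm M) (hf : Continuous f) (hf' : Continuous f.symm)
    (hexp : ∃ α > (0 : ℝ), ∀ x y : M, x ≠ y → ∃ n : ℤ, α ≤ dist ((f ^ n) x) ((f ^ n) y)) :
    ∀ x : M, ¬ LyapunovStable f x := by
  intro x hx
  obtain ⟨α, hα, hexp⟩ := hexp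
  have hβ : 0 < α / 2 := half_pos hα
  have hexp' : ∀ x y : M, (∀ n : ℤ, dist ((f ^ n) x) ((f ^ n) y) ≤ α / 2) → x = y := by
    intro x y h
    by_contra hne
    obtain ⟨n, hn⟩ := hexp x y hne
    linarith [h n]
  obtain ⟨δ₁, hδ₁, hstable⟩ := hx.exists_forall_dist_lt hf hf' hβ hexp'
  obtain ⟨δ₂, hδ₂, hclose⟩ := hx α hα
  obtain ⟨y, hyδ, hyx⟩ : ∃ y, dist x y < min δ₁ δ₂ ∧ y ≠ x := by
    obtain ⟨y, hy⟩ := Filter.nonempty_of_mem (inter_mem_nhdsWithin {x}ᶜ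
      (Metric.ball_mem_nhds x (lt_min hδ₁ hδ₂)))
    exact ⟨y, Metric.mem_ball'.1 hy.2, hy.1⟩
  obtain ⟨hy₁, hy₂⟩ := lt_min_iff.1 hyδ
  obtain ⟨a, ha, hxa⟩ := hx.exists_pow_eq_self hf hf' hβ hexp'
  obtain ⟨b, hb, hyb⟩ := (hstable y hy₁).exists_pow_eq_self hf hf' hβ hexp'
  obtain ⟨n, hn⟩ := hexp x y hyx.symm
  have hxP : (f ^ (a * b * n.natAbs)) x = x := by
    rw [mul_assoc, pow_mul]
    exact Equiv.Perm.pow_apply_eq_self_of_apply_eq_self hxa _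
  have hyP : (f ^ (a * b * n.natAbs)) y = y := by
    rw [mul_comm a b, mul_assoc, pow_mul]
    exact Equiv.Perm.pow_apply_eq_self_of_apply_eq_self hyb _
  have hnonneg : 0 ≤ n + (a * b * n.natAbs : ℕ) := by
    have : n.natAbs ≤ a * b * n.natAbs := Nat.le_mul_of_pos_left _ (Nat.mul_pos ha hb)
    lia
  obtain ⟨m, hm⟩ := Int.eq_ofNat_of_zero_le hnonneg
  have h := hclose y hy₂ m
  rw [← zpow_natCast, ← hm, zpow_add, zpow_natCast, Equiv.Perm.mul_apply,
    Equiv.Perm.mul_apply, hxP, hyP] at h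
  exact h.not_ge hn
end

section
/- Suppose M is a compact, connected, locally connected metric space with more than one point and f is an expansive homeomorphism of M with expansivity constant α, and let 0 < ε < α. Then there exists δ > 0 such that for every x ∈ M the connected component of S_ε(x) ∩ closure(B_δ(x)) containing x intersects the boundary sphere ∂B_δ(x). -/
open Set Filter Topology Metric

namespace ExpansiveHomeo

variable {M : Type*} [MetricSpace M]

theorem continuous_zpow {f : Equiv.Perm M} (hf : Continuous f) (hf' : Continuous f.symm) (n : ℤ) :
    Continuous (f ^ n : Equiv.Perm M) := by
  have key : ∀ (g : Equiv.Perm M), Continuous g → ∀ k : ℕ, Continuous (g ^ k : Equiv.Perm M) := by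
    intro g hg k
    rw [Equiv.Perm.coe_pow]
    exact hg.iterate k
  obtain ⟨k, rfl | rfl⟩ := n.eq_nat_or_neg
  · simpa using key f hf k
  · rw [zpow_neg, zpow_natCast, ← inv_pow]
    exact key f⁻¹ hf' k

/-- Points that stay `ε`-close for a long enough time window are `η`-close. -/
theorem exists_window [CompactSpace M] {f : Equiv.Perm M}
    (hc : ∀ n : ℤ, Continuous (f ^ n : Equiv.Perm M)) {ε η : ℝ}
    (hexp : ∀ x y : M, (∀ n : ℤ, dist ((f ^ n) x) ((f ^ n) y) ≤ ε) → x = y) (hη : 0 < η) :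
    ∃ N : ℕ, ∀ x y : M,
      (∀ j : ℤ, j.natAbs ≤ N → dist ((f ^ j) x) ((f ^ j) y) ≤ ε) → dist x y < η := by
  have hK : IsCompact {p : M × M | η ≤ dist p.1 p.2} :=
    (isClosed_le continuous_const continuous_dist).isCompact
  obtain ⟨t, ht⟩ := hK.elim_finite_subfamily_closed
    (fun j : ℤ => {p : M × M | dist ((f ^ j) p.1) ((f ^ j) p.2) ≤ ε})
    (fun j => isClosed_le (((hc j).comp continuous_fst).dist ((hc j).comp continuous_snd))
      continuous_const)
    (by
      ext ⟨x, y⟩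
      simp only [mem_inter_iff, mem_ofPred_eq, mem_iInter, mem_empty_iff_false, iff_false, not_and]
      intro h1 h2
      have := hexp x y h2
      subst this
      rw [dist_self] at h1
      exact absurd hη (not_lt.2 h1))
  refine ⟨t.sup Int.natAbs, fun x y h => ?_⟩
  by_contra hlt
  have : (x, y) ∈ (∅ : Set (M × M)) := by
    rw [← ht]
    refine ⟨not_lt.1 hlt, ?_⟩
    simp only [mem_iInter]
    exact fun j hj => h j (Finset.le_sup (f := Int.natAbs) hj)
  exact this

/-- Orbit segments that are `ε`-close throughout and very close at both ends are `ε / 2`-close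
throughout. -/
theorem exists_close_of_close_ends [CompactSpace M] {f : Equiv.Perm M}
    (hc : ∀ n : ℤ, Continuous (f ^ n : Equiv.Perm M)) {ε : ℝ} (hε : 0 < ε)
    (hexp : ∀ x y : M, (∀ n : ℤ, dist ((f ^ n) x) ((f ^ n) y) ≤ ε) → x = y) :
    ∃ δ > 0, ∀ (x y : M) (n : ℕ), dist x y < δ → dist ((f ^ (n : ℤ)) x) ((f ^ (n : ℤ)) y) < δ →
      (∀ j : ℕ, j ≤ n → dist ((f ^ (j : ℤ)) x) ((f ^ (j : ℤ)) y) ≤ ε) →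
      ∀ j : ℕ, j ≤ n → dist ((f ^ (j : ℤ)) x) ((f ^ (j : ℤ)) y) ≤ ε / 2 := by
  obtain ⟨N, hN⟩ := exists_window hc hexp (half_pos hε)
  have huc : ∀ᶠ p in uniformity M, ∀ j ∈ Finset.Icc (-(N : ℤ)) N,
      dist ((f ^ j) p.1) ((f ^ j) p.2) ≤ ε := by
    rw [eventually_all_finset]
    intro j _
    have h1 := CompactSpace.uniformContinuous_of_continuous (hc j)
    filter_upwards [h1 (dist_mem_uniformity hε)] with p hp using le_of_lt hp
  obtain ⟨δ, hδ, h⟩ := Metric.mem_uniformity_dist.1 huc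
  refine ⟨δ, hδ, fun x y n hx hy hxy j hj => (hN _ _ fun i hi => ?_).le⟩
  simp only [← Equiv.Perm.mul_apply, ← zpow_add]
  rcases lt_or_ge (i + j) 0 with h0 | h0
  · exact h hx (i + j) (Finset.mem_Icc.2 ⟨by omega, by omega⟩)
  rcases le_or_gt (i + j) n with h1 | h1
  · have := hxy (i + j).toNat (by omega)
    rwa [Int.toNat_of_nonneg h0] at this
  · have := h hy (i + j - n) (Finset.mem_Icc.2 ⟨by omega, by omega⟩)
    simpa only [← Equiv.Perm.mul_apply, ← zpow_add, sub_add_cancel] using this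

/-- In a compact locally connected space, balls of a uniform radius lie in small connected sets. -/
theorem exists_ball_subset_preconnected [CompactSpace M] [LocallyConnectedSpace M] {δ : ℝ}
    (hδ : 0 < δ) :
    ∃ r > 0, ∀ z : M, ∃ V : Set M, IsPreconnected V ∧ ball z r ⊆ V ∧ V ⊆ ball z δ := by
  have hV : ∀ z : M, ∃ V : Set M, V ⊆ ball z (δ / 2) ∧ IsOpen V ∧ z ∈ V ∧ IsConnected V :=
    fun z => locallyConnectedSpace_iff_subsets_isOpen_isConnected.1 inferInstance z _
      (ball_mem_nhds z (half_pos hδ))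
  choose V hVs hVo hVz hVc using hV
  obtain ⟨r, hr, h⟩ := lebesgue_number_lemma_of_metric isCompact_univ hVo
    (fun z _ => mem_iUnion.2 ⟨z, hVz z⟩)
  refine ⟨r, hr, fun z => ?_⟩
  obtain ⟨i, hi⟩ := h z (mem_univ z)
  refine ⟨V i, (hVc i).isPreconnected, hi, fun w hw => ?_⟩
  have h1 := mem_ball.1 (hVs i hw)
  have h2 := mem_ball.1 (hVs i (hi (mem_ball_self hr)))
  have h3 := dist_triangle_right w z i
  rw [mem_ball]
  linarith

/-- `x` has an open neighbourhood, with any two points less than `δ` apart, such that the orbit of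
every point of its frontier separates from that of `x` by more than `ε` within a bounded time. -/
def Trapped (f : Equiv.Perm M) (ε δ : ℝ) (x : M) : Prop :=
  ∃ O : Set M, IsOpen O ∧ x ∈ O ∧ (∀ y ∈ O, ∀ z ∈ O, dist y z < δ) ∧
    ∃ n : ℕ, ∀ y ∈ frontier O, ∃ j : ℕ, j ≤ n ∧ ε < dist ((f ^ (j : ℤ)) x) ((f ^ (j : ℤ)) y)

theorem Trapped.eventually [CompactSpace M] {f : Equiv.Perm M}
    (hc : ∀ n : ℤ, Continuous (f ^ n : Equiv.Perm M)) {ε δ : ℝ} {x : M}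
    (h : Trapped f ε δ x) : ∀ᶠ w in 𝓝 x, Trapped f ε δ w := by
  obtain ⟨O, hO, hx, hd, n, hn⟩ := h
  have h1 : ∀ᶠ w in 𝓝 x, ∀ y ∈ frontier O,
      ∃ j : ℕ, j ≤ n ∧ ε < dist ((f ^ (j : ℤ)) w) ((f ^ (j : ℤ)) y) := by
    refine isClosed_frontier.isCompact.eventually_forall_of_forall_eventually fun y hy => ?_
    obtain ⟨j, hj, hlt⟩ := hn y hy
    have hcont : Continuous fun p : M × M => dist ((f ^ (j : ℤ)) p.1) ((f ^ (j : ℤ)) p.2) :=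
      ((hc j).comp continuous_fst).dist ((hc j).comp continuous_snd)
    filter_upwards [(hcont.tendsto (x, y)).eventually (lt_mem_nhds hlt)] with p hp
    exact ⟨j, hj, hp⟩
  filter_upwards [h1, hO.mem_nhds hx] with w hw hwO
  exact ⟨O, hO, hwO, hd, n, hw⟩

/-- If the component of `x` in the local stable set misses the sphere, then `x` is trapped. -/
theorem trapped_of_component_disjoint_sphere [CompactSpace M] {f : Equiv.Perm M}
    (hc : ∀ n : ℤ, Continuous (f ^ n : Equiv.Perm M)) {ε δ : ℝ} (hε : 0 < ε) (hδ : 0 < δ) {x : M}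
    (h : ¬ (connectedComponentIn
          ({y : M | ∀ n : ℕ, dist ((f ^ n) x) ((f ^ n) y) ≤ ε} ∩ closedBall x (δ / 2)) x
        ∩ sphere x (δ / 2)).Nonempty) : Trapped f ε δ x := by
  set S : Set M := {y : M | ∀ n : ℕ, dist ((f ^ n) x) ((f ^ n) y) ≤ ε} with hS
  set D : Set M := S ∩ closedBall x (δ / 2) with hD
  have hSc : IsClosed S := by
    rw [hS, ofPred_forall]
    refine isClosed_iInter fun n => isClosed_le (continuous_const.dist ?_) continuous_const
    simpa using hc n
  have hxD : x ∈ D := ⟨fun n => by simpa using hε.le, mem_closedBall_self (half_pos hδ).le⟩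
  have hDc : IsClosed D := hSc.inter isClosed_closedBall
  have : CompactSpace D := isCompact_iff_compactSpace.1 hDc.isCompact
  obtain ⟨E, hE, hxE, hEs⟩ : ∃ E : Set D, IsClopen E ∧ (⟨x, hxD⟩ : D) ∈ E ∧
      ∀ y ∈ E, (y : M) ∉ sphere x (δ / 2) := by
    have hK : IsCompact ((↑) ⁻¹' sphere x (δ / 2) : Set D) :=
      (isClosed_sphere.preimage continuous_subtype_val).isCompact
    obtain ⟨t, ht⟩ := hK.elim_finite_subfamily_closed
      (fun s : { s : Set D // IsClopen s ∧ (⟨x, hxD⟩ : D) ∈ s } => (s : Set D))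
      (fun s => s.2.1.isClosed) (by
        rw [← connectedComponent_eq_iInter_isClopen, eq_empty_iff_forall_notMem]
        rintro y ⟨hy1, hy2⟩
        refine h ⟨y, ?_, hy1⟩
        rw [connectedComponentIn_eq_image hxD]
        exact ⟨y, hy2, rfl⟩)
    refine ⟨⋂ s ∈ t, (s : Set D), t.finite_toSet.isClopen_biInter fun s _ => s.2.1,
      mem_iInter₂.2 fun s _ => s.2.2, fun y hy hys => ?_⟩
    have : y ∈ (∅ : Set D) := by
      rw [← ht]
      exact ⟨hys, hy⟩
    exact this
  have hval := hDc.isClosedEmbedding_subtypeVal.isClosedMap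
  obtain ⟨O, hO, hEO, hOs⟩ := normal_exists_closure_subset (hval E hE.isClosed)
    ((hval Eᶜ hE.compl.isClosed).isOpen_compl.inter (isOpen_ball (x := x) (ε := δ / 2))) (by
      rintro _ ⟨y, hy, rfl⟩
      refine ⟨?_, ?_⟩
      · rintro ⟨z, hz, hzy⟩
        exact hz (Subtype.ext hzy ▸ hy)
      · exact lt_of_le_of_ne y.2.2 (hEs y hy))
  obtain ⟨t, ht⟩ := (isClosed_frontier (s := O)).isCompact.elim_finite_subfamily_closed
    (fun j : ℕ => {y : M | dist ((f ^ (j : ℤ)) x) ((f ^ (j : ℤ)) y) ≤ ε})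
    (fun j => isClosed_le (continuous_const.dist (hc j)) continuous_const) (by
      rw [eq_empty_iff_forall_notMem]
      rintro y ⟨hy, hyS⟩
      have hyO := hOs (frontier_subset_closure hy)
      have hyD : y ∈ D := by
        refine ⟨fun n => ?_, ball_subset_closedBall hyO.2⟩
        simpa using mem_iInter.1 hyS n
      have hyE : (⟨y, hyD⟩ : D) ∈ E := by
        by_contra hne
        exact hyO.1 ⟨⟨y, hyD⟩, hne, rfl⟩
      rw [hO.frontier_eq] at hy
      exact hy.2 (hEO ⟨_, hyE, rfl⟩))
  refine ⟨O, hO, hEO ⟨_, hxE, rfl⟩, fun y hy z hz => ?_, t.sup id, fun y hy => ?_⟩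
  · have h1 := mem_ball.1 (hOs (subset_closure hy)).2
    have h2 := mem_ball.1 (hOs (subset_closure hz)).2
    have h3 := dist_triangle_right y z x
    linarith
  · by_contra! hcon
    have : y ∈ (∅ : Set M) := by
      rw [← ht]
      exact ⟨hy, mem_iInter₂.2 fun j hj => hcon j (Finset.le_sup (f := id) hj)⟩
    exact this

/-- Around the late iterates of `x`, balls of radius `r` contract under backward iteration. -/
def BackwardStable (f : Equiv.Perm M) (ε r : ℝ) (x : M) : Prop :=
  ∃ n₀ : ℕ, ∀ n ≥ n₀, ∀ y : M, dist ((f ^ (n : ℤ)) x) ((f ^ (n : ℤ)) y) < r →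
    ∀ j : ℕ, j ≤ n → dist ((f ^ (j : ℤ)) x) ((f ^ (j : ℤ)) y) ≤ ε / 2

theorem Trapped.backwardStable {f : Equiv.Perm M}
    (hc : ∀ n : ℤ, Continuous (f ^ n : Equiv.Perm M)) {ε δ r : ℝ} (hε : 0 < ε) (hr : 0 < r)
    (hδ : ∀ (x y : M) (n : ℕ), dist x y < δ → dist ((f ^ (n : ℤ)) x) ((f ^ (n : ℤ)) y) < δ →
      (∀ j : ℕ, j ≤ n → dist ((f ^ (j : ℤ)) x) ((f ^ (j : ℤ)) y) ≤ ε) →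
      ∀ j : ℕ, j ≤ n → dist ((f ^ (j : ℤ)) x) ((f ^ (j : ℤ)) y) ≤ ε / 2)
    (hV : ∀ z : M, ∃ V : Set M, IsPreconnected V ∧ ball z r ⊆ V ∧ V ⊆ ball z δ) {x : M}
    (h : Trapped f ε δ x) : BackwardStable f ε r x := by
  obtain ⟨O, hO, hxO, hd, n₀, hn₀⟩ := h
  refine ⟨n₀, fun n hn y hy => ?_⟩
  obtain ⟨V, hVc, hVr, hVδ⟩ := hV ((f ^ (n : ℤ)) x)
  have hxV : (f ^ (n : ℤ)) x ∈ V := hVr (mem_ball_self hr)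
  have hyV : (f ^ (n : ℤ)) y ∈ V := hVr (by rwa [mem_ball'])
  have hinv : ∀ w : M, (f ^ (-n : ℤ)) ((f ^ (n : ℤ)) w) = w := fun w => by
    simp only [← Equiv.Perm.mul_apply, ← zpow_add, neg_add_cancel, zpow_zero, Equiv.Perm.one_apply]
  have hinv' : ∀ w : M, (f ^ (n : ℤ)) ((f ^ (-n : ℤ)) w) = w := fun w => by
    simp only [← Equiv.Perm.mul_apply, ← zpow_add, add_neg_cancel, zpow_zero, Equiv.Perm.one_apply]
  set A : Set M := {w | ∀ j : ℕ, j ≤ n → dist ((f ^ (j : ℤ)) x) ((f ^ (j : ℤ)) w) ≤ ε} with hA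
  set B : Set M := {w | ∀ j : ℕ, j ≤ n → dist ((f ^ (j : ℤ)) x) ((f ^ (j : ℤ)) w) < ε} with hB
  have hBo : IsOpen B := by
    have : B = ⋂ j ∈ Finset.range (n + 1), {w | dist ((f ^ (j : ℤ)) x) ((f ^ (j : ℤ)) w) < ε} := by
      ext w
      simp [hB]
    rw [this]
    exact isOpen_biInter_finset fun j _ =>
      isOpen_lt (continuous_const.dist (hc j)) continuous_const
  have hAc : IsClosed A := by
    simp only [hA, ofPred_forall]
    exact isClosed_iInter fun j => isClosed_iInter fun _ =>
      isClosed_le (continuous_const.dist (hc j)) continuous_const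
  have hclose : ∀ w ∈ O ∩ A, (f ^ (n : ℤ)) w ∈ V →
      ∀ j : ℕ, j ≤ n → dist ((f ^ (j : ℤ)) x) ((f ^ (j : ℤ)) w) ≤ ε / 2 :=
    fun w hw hwV => hδ x w n (hd x hxO w hw.1) (mem_ball'.1 (hVδ hwV)) hw.2
  have hcl : closure O ∩ A ⊆ O := by
    rintro w ⟨hw, hwA⟩
    by_contra hwO
    obtain ⟨j, hj, hlt⟩ := hn₀ w (hO.frontier_eq ▸ ⟨hw, hwO⟩)
    exact absurd (hwA j (hj.trans hn)) (not_le.2 hlt)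
  have hsub : V ⊆ (f ^ (-n : ℤ) : Equiv.Perm M) ⁻¹' (O ∩ B) := by
    refine hVc.subset_of_closure_inter_subset ((hO.inter hBo).preimage (hc _))
      ⟨(f ^ (n : ℤ)) x, hxV, ?_⟩ ?_
    · rw [mem_preimage, hinv]
      exact ⟨hxO, fun j _ => by simpa using hε⟩
    · rintro w ⟨hw, hwV⟩
      have hw' : (f ^ (-n : ℤ)) w ∈ closure O ∩ A := by
        have hcloA : IsClosed ((f ^ (-n : ℤ) : Equiv.Perm M) ⁻¹' (closure O ∩ A)) :=
          (isClosed_closure.inter hAc).preimage (hc _)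
        exact closure_minimal (preimage_mono (inter_subset_inter subset_closure
          fun v hv j hj => (hv j hj).le)) hcloA hw
      refine ⟨hcl hw', fun j hj => ?_⟩
      have := hclose _ ⟨hcl hw', hw'.2⟩ (by rwa [hinv']) j hj
      linarith
  have hyO := hsub hyV
  rw [mem_preimage, hinv] at hyO
  exact hclose y ⟨hyO.1, fun j hj => (hyO.2 j hj).le⟩ hyV

theorem BackwardStable.dist_le_of_tendsto {f : Equiv.Perm M}
    (hc : ∀ n : ℤ, Continuous (f ^ n : Equiv.Perm M)) {ε r : ℝ} {x q : M}
    (h : BackwardStable f ε r x) {T : ℕ → ℕ} (hT : Tendsto T atTop atTop)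
    (hq : Tendsto (fun m => (f ^ (T m : ℤ)) x) atTop (𝓝 q)) {w : M} (hw : dist q w < r) (l : ℕ) :
    dist ((f ^ (-l : ℤ)) q) ((f ^ (-l : ℤ)) w) ≤ ε / 2 := by
  obtain ⟨n₀, hn₀⟩ := h
  have h1 : Tendsto (fun m => dist ((f ^ (-l : ℤ)) ((f ^ (T m : ℤ)) x)) ((f ^ (-l : ℤ)) w)) atTop
      (𝓝 (dist ((f ^ (-l : ℤ)) q) ((f ^ (-l : ℤ)) w))) :=
    (((hc (-l)).tendsto q).comp hq).dist tendsto_const_nhds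
  refine le_of_tendsto h1 ?_
  filter_upwards [(hq.dist (tendsto_const_nhds (x := w))).eventually (gt_mem_nhds hw),
    hT.eventually_ge_atTop n₀, hT.eventually_ge_atTop l] with m hm1 hm2 hm3
  have := hn₀ (T m) hm2 ((f ^ (-T m : ℤ)) w)
    (by simpa only [← Equiv.Perm.mul_apply, ← zpow_add, add_neg_cancel, zpow_zero,
      Equiv.Perm.one_apply] using hm1) (T m - l) (Nat.sub_le _ _)
  simp only [← Equiv.Perm.mul_apply, ← zpow_add] at this ⊢
  rwa [Nat.cast_sub hm3, show ((T m : ℤ) - l) + -T m = -l by ring,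
    sub_eq_neg_add (T m : ℤ)] at this

theorem BackwardStable.periodic [CompactSpace M] {f : Equiv.Perm M}
    (hc : ∀ n : ℤ, Continuous (f ^ n : Equiv.Perm M)) {ε r : ℝ} (hr : 0 < r)
    (hexp : ∀ x y : M, (∀ n : ℤ, dist ((f ^ n) x) ((f ^ n) y) ≤ ε) → x = y) {x : M}
    (h : BackwardStable f ε r x) : ∃ k : ℕ, 0 < k ∧ (f ^ (k : ℤ)) x = x := by
  obtain ⟨q₀, φ, hφ, hq₀⟩ := CompactSpace.tendsto_subseq fun n : ℕ => (f ^ (n : ℤ)) x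
  obtain ⟨i, k, hk, hik⟩ : ∃ i k : ℕ, 0 < k ∧
      dist ((f ^ (i : ℤ)) q₀) ((f ^ (k : ℤ)) ((f ^ (i : ℤ)) q₀)) < r := by
    obtain ⟨p, ψ, hψ, hp⟩ := CompactSpace.tendsto_subseq fun n : ℕ => (f ^ (n : ℤ)) q₀
    obtain ⟨N, hN⟩ := Metric.cauchySeq_iff.1 hp.cauchySeq r hr
    have hlt := hψ (Nat.lt_add_one N)
    refine ⟨ψ N, ψ (N + 1) - ψ N, by omega, ?_⟩
    have := hN N le_rfl (N + 1) (Nat.le_succ N)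
    simp only [Function.comp_apply] at this
    rw [← Equiv.Perm.mul_apply, ← zpow_add]
    convert this using 4
    omega
  set q := (f ^ (i : ℤ)) q₀ with hq
  have hT : Tendsto (fun m => φ m + i) atTop atTop :=
    tendsto_atTop_mono (fun m => Nat.le_add_right _ _) hφ.tendsto_atTop
  have hTq : Tendsto (fun m => (f ^ ((φ m + i : ℕ) : ℤ)) x) atTop (𝓝 q) := by
    have := ((hc i).tendsto q₀).comp hq₀
    refine this.congr fun m => ?_
    simp only [Function.comp_apply, ← Equiv.Perm.mul_apply, ← zpow_add]
    congr 2
    push_cast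
    ring
  have hTk := ((hc k).tendsto q).comp hTq
  refine ⟨k, hk, (hexp _ _ fun s => ?_).symm⟩
  obtain ⟨m, hm1, hm2, hm3⟩ := ((((tendsto_const_nhds (x := q)).dist hTq).eventually
    (gt_mem_nhds (by simpa using hr : dist q q < r))).and
    ((((tendsto_const_nhds (x := q)).dist hTk).eventually (gt_mem_nhds hik)).and
      (hT.eventually_ge_atTop s.toNat))).exists
  have h1 := h.dist_le_of_tendsto hc hT hTq hm1 ((φ m + i : ℕ) - s).toNat
  have h2 := h.dist_le_of_tendsto hc hT hTq hm2 ((φ m + i : ℕ) - s).toNat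
  have h3 := (dist_triangle_left _ _ _).trans (add_le_add h1 h2)
  rw [add_halves] at h3
  have hs : (((((φ m + i : ℕ) : ℤ) - s).toNat : ℕ) : ℤ) = ((φ m + i : ℕ) : ℤ) - s :=
    Int.toNat_of_nonneg (by omega)
  simp only [Function.comp_apply, ← Equiv.Perm.mul_apply, ← zpow_add, hs] at h3 ⊢
  rwa [neg_sub, sub_add_cancel, add_left_comm, sub_add_cancel, add_comm (k : ℤ)] at h3

theorem zpow_mul_apply_of_fixed {X : Type*} {f : Equiv.Perm X} {x : X} {k : ℤ} (h : (f ^ k) x = x) (m : ℤ) :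
    (f ^ (k * m)) x = x := by
  rw [zpow_mul]
  exact Function.IsFixedPt.perm_zpow h m

/-- An expansive homeomorphism of a nontrivial connected space has no trapped points. -/
theorem not_trapped [CompactSpace M] [ConnectedSpace M] [Nontrivial M] {f : Equiv.Perm M}
    (hc : ∀ n : ℤ, Continuous (f ^ n : Equiv.Perm M)) {ε δ r : ℝ} (hε : 0 < ε) (hr : 0 < r)
    (hexp : ∀ x y : M, (∀ n : ℤ, dist ((f ^ n) x) ((f ^ n) y) ≤ ε) → x = y)
    (hback : ∀ x : M, Trapped f ε δ x → BackwardStable f ε r x) (x : M) : ¬ Trapped f ε δ x := by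
  intro hx
  obtain ⟨k, hk, hkx⟩ := (hback x hx).periodic hc hr hexp
  obtain ⟨w, ⟨hw, hwr⟩, hwx⟩ := (((hx.eventually hc).and (ball_mem_nhds x hr)).filter_mono
    nhdsWithin_le_nhds |>.and (self_mem_nhdsWithin (s := {x}ᶜ))).exists
  obtain ⟨l, hl, hlw⟩ := (hback w hw).periodic hc hr hexp
  refine hwx (hexp x w fun s => ?_).symm
  have hT : Tendsto (fun m => k * m) atTop atTop := tendsto_id.const_mul_atTop' hk
  have hTx : Tendsto (fun m : ℕ => (f ^ ((k * m : ℕ) : ℤ)) x) atTop (𝓝 x) := by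
    refine tendsto_const_nhds.congr fun m => ?_
    rw [Nat.cast_mul, zpow_mul_apply_of_fixed hkx]
  have h1 := (hback x hx).dist_le_of_tendsto hc hT hTx (mem_ball'.1 hwr)
    (k * l * s.natAbs - s).toNat
  have hpos : s ≤ (k : ℤ) * l * s.natAbs := by
    have : (1 : ℤ) ≤ k * l := by exact_mod_cast Nat.mul_pos hk hl
    have h0 : s ≤ s.natAbs := by omega
    nlinarith [Int.natCast_nonneg s.natAbs]
  rw [Int.toNat_of_nonneg (by omega)] at h1
  have e : -((k : ℤ) * l * s.natAbs - s) = s + k * (l * -s.natAbs) := by ring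
  have e' : -((k : ℤ) * l * s.natAbs - s) = s + l * (k * -s.natAbs) := by ring
  have hx' : (f ^ (-((k : ℤ) * l * s.natAbs - s))) x = (f ^ s) x := by
    rw [e, zpow_add, Equiv.Perm.mul_apply, zpow_mul_apply_of_fixed hkx]
  have hw' : (f ^ (-((k : ℤ) * l * s.natAbs - s))) w = (f ^ s) w := by
    rw [e', zpow_add, Equiv.Perm.mul_apply, zpow_mul_apply_of_fixed hlw]
  rw [hx', hw'] at h1
  linarith

end ExpansiveHomeo

/-- local stable sets have uniform size: there is δ > 0 such that for
every x the connected component containing x of S_ε(x) ∩ closure(B_δ(x)) meets the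
sphere ∂B_δ(x). -/
theorem local_stable_sets_uniform_size {M : Type*} [MetricSpace M] [CompactSpace M]
    [ConnectedSpace M] [LocallyConnectedSpace M] [Nontrivial M]
    (f : Equiv.Perm M) (hf : Continuous f) (hf' : Continuous f.symm)
    (α : ℝ) (hα : 0 < α)
    (hexp : ∀ x y : M, x ≠ y → ∃ n : ℤ, α ≤ dist ((f ^ n) x) ((f ^ n) y))
    (ε : ℝ) (hε : 0 < ε) (hεα : ε < α) :
    ∃ δ > (0 : ℝ), ∀ x : M,
      (connectedComponentIn
          ({y : M | ∀ n : ℕ, dist ((f ^ n) x) ((f ^ n) y) ≤ ε} ∩ Metric.closedBall x δ) x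
        ∩ Metric.sphere x δ).Nonempty := by
  have hc := ExpansiveHomeo.continuous_zpow hf hf'
  have hexp' : ∀ x y : M, (∀ n : ℤ, dist ((f ^ n) x) ((f ^ n) y) ≤ ε) → x = y := by
    intro x y h
    by_contra hxy
    obtain ⟨n, hn⟩ := hexp x y hxy
    linarith [h n]
  obtain ⟨δ, hδ, hclose⟩ := ExpansiveHomeo.exists_close_of_close_ends hc hε hexp'
  obtain ⟨r, hr, hV⟩ := ExpansiveHomeo.exists_ball_subset_preconnected (M := M) hδ
  refine ⟨δ / 2, half_pos hδ, fun x => ?_⟩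
  by_contra hx
  exact ExpansiveHomeo.not_trapped hc hε hr hexp'
    (fun y hy => hy.backwardStable hc hε hr hclose hV) x
    (ExpansiveHomeo.trapped_of_component_disjoint_sphere hc hε hδ hx)
end
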